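/- In any alternative algebra over a field of characteristic 0 (or in which 2 is invertible), [a^2, x]∘(a,y,z) = [a,x]∘(a^2,y,z), where [a,b] = ab - ba, a∘b = ab + ba, and (x,y,z) = (xy)z - x(yz). -/

import Mathlib

variable {A : Type*} [NonUnitalNonAssocRing A]

/-- Commutator `[x,y] = xy - yx`. -/
def altComm (x y : A) : A := x * y - y * x

/-- Associator `(x,y,z) = (xy)z - x(yz)`. -/
def altAssoc (x y z : A) : A := (x * y) * z - x * (y * z)

/-- Jordan product `x ∘ y = xy + yx`. -/
def altSop (x y : A) : A := x * y + y * x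

/-- Jacobian `J(a,b,c) = [[a,b],c] + [[b,c],a] + [[c,a],b]`. -/
def altJac (x y z : A) : A := altComm (altComm x y) z + altComm (altComm y z) x + altComm (altComm z x) y

/-- `D(a,b,c) = (a∘b)∘c - (a∘c)∘b`. -/
def altDop (x y z : A) : A := altSop (altSop x y) z - altSop (altSop x z) y

section helpers

theorem as_add1 (x x' y z : A) : altAssoc (x + x') y z = altAssoc x y z + altAssoc x' y z := by
  simp only [altAssoc, add_mul]; abel
theorem as_add2 (x x' y z : A) : altAssoc y (x + x') z = altAssoc y x z + altAssoc y x' z := by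
  simp only [altAssoc, add_mul, mul_add]; abel
theorem as_add3 (x x' y z : A) : altAssoc y z (x + x') = altAssoc y z x + altAssoc y z x' := by
  simp only [altAssoc, mul_add]; abel
theorem as_sub2 (x x' y z : A) : altAssoc y (x - x') z = altAssoc y x z - altAssoc y x' z := by
  simp only [altAssoc, sub_mul, mul_sub]; abel
theorem as_sub3 (x x' y z : A) : altAssoc y z (x - x') = altAssoc y z x - altAssoc y z x' := by
  simp only [altAssoc, mul_sub]; abel
theorem as_neg3 (x y z : A) : altAssoc y z (-x) = - altAssoc y z x := by
  simp only [altAssoc, mul_neg]; abel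

theorem as_teich (w x y z : A) : altAssoc (w * x) y z - altAssoc w (x * y) z + altAssoc w x (y * z)
    = w * altAssoc x y z + altAssoc w x y * z := by
  simp only [altAssoc, mul_sub, sub_mul]; abel

theorem as_sw12 (l : ∀ x y : A, altAssoc x x y = 0)
    (x y z : A) : altAssoc x y z = - altAssoc y x z := by
  have h := l (x + y) z
  rw [as_add1, as_add2, as_add2, l, l] at h
  linear_combination (norm := abel) h

theorem as_sw23 (r : ∀ x y : A, altAssoc y x x = 0)
    (x y z : A) : altAssoc x y z = - altAssoc x z y := by
  have h := r (y + z) x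
  rw [as_add2, as_add3, as_add3, r, r] at h
  linear_combination (norm := abel) h

theorem as_flex (l : ∀ x y : A, altAssoc x x y = 0)
    (r : ∀ x y : A, altAssoc y x x = 0) (x y : A) : altAssoc x y x = 0 := by
  rw [as_sw12 l, r, neg_zero]

theorem as_rot (l : ∀ x y : A, altAssoc x x y = 0)
    (r : ∀ x y : A, altAssoc y x x = 0) (x y z : A) : altAssoc x y z = altAssoc y z x := by
  rw [as_sw12 l, as_sw23 r, neg_neg]

theorem as_sq (l : ∀ x y : A, altAssoc x x y = 0)
    (r : ∀ x y : A, altAssoc y x x = 0) (a y z : A) : altAssoc (a * a) y z = a * altAssoc a y z + altAssoc a y z * a ∧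
    altAssoc a (a * y) z = altAssoc a y z * a ∧ altAssoc a (y * a) z = a * altAssoc a y z := by
  have h1 : ∀ y z, altAssoc (a * a) y z = altAssoc a (a * y) z + a * altAssoc a y z := by
    intro y z
    have h := as_teich a a y z
    simp only [l, zero_mul] at h
    linear_combination (norm := abel) h
  have h2 : altAssoc (a * a) y z = altAssoc a (y * a) z + altAssoc a y z * a := by
    have h := as_teich z y a a
    simp only [r, mul_zero] at h
    rw [← as_rot l r (a * a) z y, as_sw23 r (a * a), ← as_rot l r a z (y * a), as_sw23 r a z,
      ← as_rot l r a z y, as_sw23 r a z y, neg_mul] at h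
    linear_combination (norm := abel) -h
  have h3 := as_teich a y a z
  rw [as_flex l r, zero_mul, as_sw12 l (a * y), as_sw12 l y a z, as_sw23 r a y (a * z), mul_neg] at h3
  have h4 := h1 z y
  rw [as_sw23 r (a * a), as_sw23 r a z y, mul_neg] at h4
  have h5 := h1 y z
  refine ⟨?_, ?_, ?_⟩
  · linear_combination (norm := abel) h5 + h2 + h4 - h3
  · linear_combination (norm := abel) h2 + h4 - h3
  · linear_combination (norm := abel) h5 + h4 - h3

/-- Kleinfeld function. -/
def kl (w x y z : A) : A := altAssoc (w * x) y z - x * altAssoc w y z - altAssoc x y z * w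

theorem kl_cyc (l : ∀ x y : A, altAssoc x x y = 0)
    (r : ∀ x y : A, altAssoc y x x = 0) (w x y z : A) : kl w x y z = - kl z w x y := by
  have h1 := as_teich w x y z
  have h2 := as_teich x y z w
  rw [as_rot l r w (x * y) z, ← as_rot l r (y * z) w x] at h1
  rw [as_rot l r x (y * z) w, ← as_rot l r (z * w) x y] at h2
  rw [as_sw23 r (y * z) w x] at h1
  rw [as_sw23 r (y * z) w x] at h2
  simp only [kl]
  rw [as_rot l r w y z, as_rot l r z x y]
  linear_combination (norm := abel) h1 + h2

theorem kl_swap (l : ∀ x y : A, altAssoc x x y = 0)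
    (r : ∀ x y : A, altAssoc y x x = 0) (w x y z : A) : kl w x y z = kl y z w x := by
  rw [kl_cyc l r w x y z, kl_cyc l r z w x y, neg_neg]

theorem key_left (l : ∀ x y : A, altAssoc x x y = 0)
    (r : ∀ x y : A, altAssoc y x x = 0) (a x z : A) :
    altAssoc a x (altAssoc a x z) = altComm a x * altAssoc a x z := by
  have hd : altAssoc a x z = (z * a) * x - z * (a * x) := by
    rw [← as_rot l r z a x]; rfl
  have e1 : ∀ t, altAssoc a x (t * x) = x * altAssoc a x t := by
    intro t
    rw [as_rot l r a x, (as_sq l r x t a).2.2, ← as_rot l r a x t]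
  have e2 : ∀ t, altAssoc a x (t * a) = a * altAssoc a x t := by
    intro t
    rw [as_sw23 r, (as_sq l r a t x).2.2, as_sw23 r a t x, mul_neg, neg_neg]
  have h1 : altAssoc a x (altAssoc a x z) =
      x * (a * altAssoc a x z) - altAssoc a x (z * (a * x)) := by
    rw [← e2, ← e1, ← as_sub3, ← hd]
  have h2 := kl_swap l r z (a * x) a x
  simp only [kl] at h2
  have q1 : altAssoc (a * x) a x = 0 := by
    rw [as_rot l r, as_sw23 r, (as_sq l r a x x).2.1, r, zero_mul, neg_zero]
  have q2 : altAssoc a z (a * x) = - (altAssoc a x z * a) := by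
    rw [as_sw23 r, (as_sq l r a x z).2.1]
  have q3 : altAssoc x z (a * x) = x * altAssoc a x z := by
    rw [as_sw23 r, (as_sq l r x a z).2.2, as_sw12 l x a z, mul_neg, neg_neg]
  rw [as_rot l r (z * (a * x)) a x, as_rot l r z a x, q1, q2, q3, as_flex l r, zero_mul,
    mul_neg] at h2
  generalize altAssoc a x z = w at *
  have h3 := as_rot l r a x w
  have h4 := as_sw12 l a x w
  simp only [altAssoc, altComm, sub_mul] at h1 h2 h3 h4 ⊢
  linear_combination (norm := abel) h4 - h1 + h2 + h3

theorem key_right (l : ∀ x y : A, altAssoc x x y = 0)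
    (r : ∀ x y : A, altAssoc y x x = 0) (a x z : A) :
    altAssoc a x (altAssoc a x z) = - (altAssoc a x z * altComm a x) := by
  have e1 : ∀ t, altAssoc a x (a * t) = altAssoc a x t * a := by
    intro t
    rw [as_sw23 r, (as_sq l r a t x).2.1, as_sw23 r a t x, neg_mul, neg_neg]
  have e2 : ∀ t, altAssoc a x (x * t) = altAssoc a x t * x := by
    intro t
    rw [as_rot l r a x, (as_sq l r x t a).2.1, ← as_rot l r a x t]
  have h1 : altAssoc a x (altAssoc a x z) =
      altAssoc a x (a * x * z) - (altAssoc a x z * x) * a := by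
    rw [← e2, ← e1, ← as_sub3]; rfl
  have h2 := kl_swap l r (a * x) z a x
  simp only [kl] at h2
  have q1 : altAssoc (a * x) a x = 0 := by
    rw [as_rot l r, as_sw23 r, (as_sq l r a x x).2.1, r, zero_mul, neg_zero]
  have q2 : altAssoc a (a * x) z = altAssoc a x z * a := (as_sq l r a x z).2.1
  have q3 : altAssoc x (a * x) z = - (x * altAssoc a x z) := by
    rw [(as_sq l r x a z).2.2, as_sw12 l x a z, mul_neg]
  rw [as_rot l r (a * x * z) a x, as_rot l r z a x, q1, q2, q3, l, mul_zero,
    neg_mul] at h2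
  generalize altAssoc a x z = w at *
  have h3 := as_rot l r a x w
  have h4 := as_rot l r x w a
  have h5 := as_sw23 r w a x
  simp only [altAssoc, altComm, mul_sub] at h1 h2 h3 h4 h5 ⊢
  linear_combination (norm := abel) -h1 - h2 + h3 + h3 + h4 + h5

def hh (a x y z : A) : A := altComm (altComm a x) (altAssoc a y z)
  - (altAssoc a x (altAssoc a y z) + altAssoc a x (altAssoc a y z))

theorem hh_sw1 (l : ∀ x y : A, altAssoc x x y = 0)
    (r : ∀ x y : A, altAssoc y x x = 0) (a x y z : A) : hh a x y z = - hh a y x z := by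
  have h1 : ∀ x, hh a x x z = 0 := by
    intro x
    have h1 := key_left l r a x z
    have h2 := key_right l r a x z
    rw [hh, altComm]
    linear_combination (norm := abel) - h1 - h2
  have h := h1 (x + y)
  have hx := h1 x
  have hy := h1 y
  simp only [hh, altComm, as_add2, as_add3, mul_add, add_mul, mul_sub, sub_mul] at h hx hy ⊢
  linear_combination (norm := abel) h - hx - hy

theorem hh_sw2 (r : ∀ x y : A, altAssoc y x x = 0)
    (a x y z : A) : hh a x y z = - hh a x z y := by
  rw [hh, hh, as_sw23 r a y z, as_neg3]
  simp only [altComm, mul_neg, neg_mul]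
  abel

theorem as_com (l : ∀ x y : A, altAssoc x x y = 0)
    (r : ∀ x y : A, altAssoc y x x = 0) (a y z : A) :
    altAssoc a (altComm a y) z = - altComm a (altAssoc a y z) := by
  rw [altComm, altComm, as_sub2, (as_sq l r a y z).2.1, (as_sq l r a y z).2.2]
  abel

theorem as_com3 (l : ∀ x y : A, altAssoc x x y = 0)
    (r : ∀ x y : A, altAssoc y x x = 0) (a y z : A) :
    altAssoc a y (altComm a z) = - altComm a (altAssoc a y z) := by
  rw [as_sw23 r, as_com l r, as_sw23 r a z y]
  simp only [altComm, mul_neg, neg_mul]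
  abel

theorem hh_mid (l : ∀ x y : A, altAssoc x x y = 0)
    (r : ∀ x y : A, altAssoc y x x = 0) (a x y z : A) : hh a x (altComm a y) z = hh a x y (altComm a z) := by
  rw [hh, hh, as_com l r, as_com3 l r]

theorem hh_first (l : ∀ x y : A, altAssoc x x y = 0)
    (r : ∀ x y : A, altAssoc y x x = 0) (a x y z : A) : hh a (altComm a x) y z = hh a x (altComm a y) z := by
  rw [hh_sw1 l r, hh_mid l r, hh_sw1 l r a y x, neg_neg, hh_mid l r]

theorem as_jac (l : ∀ x y : A, altAssoc x x y = 0)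
    (r : ∀ x y : A, altAssoc y x x = 0) (x y z : A) : altComm x (altComm y z) =
      altComm (altComm x y) z + altComm y (altComm x z) - 6 • altAssoc x y z := by
  have h1 : altAssoc y z x = altAssoc x y z := (as_rot l r x y z).symm
  have h2 : altAssoc z x y = altAssoc x y z := as_rot l r z x y
  have h3 : altAssoc y x z = - altAssoc x y z := as_sw12 l y x z
  have h4 : altAssoc x z y = - altAssoc x y z := as_sw23 r x z y
  have h5 : altAssoc z y x = - altAssoc x y z := by rw [as_sw12 l, h1]
  simp only [altAssoc, altComm, sub_mul, mul_sub] at *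
  linear_combination (norm := abel) -h1 - h2 + h3 + h4 + h5

theorem as_jord (l : ∀ x y : A, altAssoc x x y = 0)
    (r : ∀ x y : A, altAssoc y x x = 0) (a u v : A) : altSop (altSop a u) v =
      altSop u (altSop a v) + altComm a (altComm u v) + 2 • altAssoc a u v := by
  have h1 : altAssoc u v a = altAssoc a u v := (as_rot l r a u v).symm
  have h2 : altAssoc v a u = altAssoc a u v := as_rot l r v a u
  have h3 : altAssoc u a v = - altAssoc a u v := as_sw12 l u a v
  have h4 : altAssoc a v u = - altAssoc a u v := as_sw23 r a v u
  have h5 : altAssoc v u a = - altAssoc a u v := by rw [as_sw12 l, h1]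
  simp only [altAssoc, altComm, altSop, sub_mul, mul_sub, add_mul, mul_add] at *
  linear_combination (norm := abel) h1 - h2 + h3 - h4 - h5

theorem com_neg (x y : A) : altComm x (-y) = - altComm x y := by
  simp only [altComm, mul_neg, neg_mul]
  abel

end helpers

theorem stmt_17 {F : Type*} [Field F] [CharZero F]
    [Module F A] [SMulCommClass F A A] [IsScalarTower F A A]
    (alt_left : ∀ x y : A, altAssoc x x y = 0)
    (alt_right : ∀ x y : A, altAssoc y x x = 0)
    (a x y z : A) :
    altSop (altComm (a * a) x) (altAssoc a y z) = altSop (altComm a x) (altAssoc (a * a) y z) := by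
  have l := alt_left
  have r := alt_right
  rw [(as_sq l r a y z).1]
  have hT := hh_first l r a x y z
  have hJ := as_jac l r a (altComm a x) (altAssoc a y z)
  have hc := as_com l r a x (altAssoc a y z)
  have hc3 := as_com3 l r a x (altAssoc a y z)
  simp only [hh] at hT
  rw [as_com l r a y z, as_neg3, hc3, neg_neg, hc] at hT
  rw [hc] at hJ
  have hX : altSop (altComm (a * a) x) (altAssoc a y z) = altSop (altSop a (altComm a x)) (altAssoc a y z) := by
    have h : altComm (a * a) x = altSop a (altComm a x) := by
      have h1 := l a x
      have h2 := r a x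
      have h3 := as_flex l r a x
      simp only [altAssoc, altComm, altSop, mul_sub, sub_mul] at *
      linear_combination (norm := abel) h1 + h2 - h3
    rw [h]
  rw [hX]
  have hq := as_jord l r a (altComm a x) (altAssoc a y z)
  rw [hc] at hq
  rw [com_neg] at hT
  change _ = altSop (altComm a x) (altSop a (altAssoc a y z))
  linear_combination (norm := abel) hq + hJ + hT
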